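/- Let H be a hereditary abelian category and D^b(H) its bounded derived category. Then: (1) any almost split sequence 0 → X → Y → Z → 0 in H induces an almost split triangle X → Y → Z → X[1] in D^b(H), whose connecting morphism is the class of the sequence under Ext^1_H(Z,X) ≅ Hom_{D^b(H)}(Z, X[1]); (2) if S is a simple object of H with a projective cover ε: P → S and an injective hull ι: S → I, then D^b(H) has an almost split triangle I → (I/S) ⊕ (rad P)[1] → P[1] → I[1], where rad P = ker ε and I/S = coker ι; (3) every almost split triangle in D^b(H) is isomorphic to a shift of an almost split triangle of one of these two forms. -/

import Mathlib

open CategoryTheory CategoryTheory.Limits CategoryTheory.Pretriangulated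

universe w uC vC

section AlmostSplit

universe uD vD
variable {C : Type uD} [Category.{vD} C]

/-- A morphism is a section if it admits a left inverse. -/
def IsSect {X Y : C} (f : X ⟶ Y) : Prop := ∃ r : Y ⟶ X, f ≫ r = 𝟙 X

/-- A morphism is a retraction if it admits a right inverse. -/
def IsRetr {X Y : C} (f : X ⟶ Y) : Prop := ∃ s : Y ⟶ X, s ≫ f = 𝟙 Y

/-- A morphism `g : Y ⟶ Z` is right almost split relative to the object class `P` if it is
not a retraction and every non-retraction `h : W ⟶ Z` with `W` in `P` factors through `g`. -/
def RightAS (P : C → Prop) {Y Z : C} (g : Y ⟶ Z) : Prop :=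
  ¬ IsRetr g ∧ ∀ ⦃W : C⦄, P W → ∀ h : W ⟶ Z, ¬ IsRetr h → ∃ u : W ⟶ Y, u ≫ g = h

/-- A morphism `f : X ⟶ Y` is left almost split relative to the object class `P` if it is
not a section and every non-section `h : X ⟶ W` with `W` in `P` factors through `f`. -/
def LeftAS (P : C → Prop) {X Y : C} (f : X ⟶ Y) : Prop :=
  ¬ IsSect f ∧ ∀ ⦃W : C⦄, P W → ∀ h : X ⟶ W, ¬ IsSect h → ∃ u : Y ⟶ W, f ≫ u = h

/-- A morphism `g : Y ⟶ Z` is right minimal. -/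
def RightMin {Y Z : C} (g : Y ⟶ Z) : Prop := ∀ u : Y ⟶ Y, u ≫ g = g → IsIso u

/-- A morphism `f : X ⟶ Y` is left minimal. -/
def LeftMin {X Y : C} (f : X ⟶ Y) : Prop := ∀ u : Y ⟶ Y, f ≫ u = f → IsIso u

/-- Minimal right almost split relative to the object class `P`. -/
def MinRightAS (P : C → Prop) {Y Z : C} (g : Y ⟶ Z) : Prop := RightAS P g ∧ RightMin g

/-- Minimal left almost split relative to the object class `P`. -/
def MinLeftAS (P : C → Prop) {X Y : C} (f : X ⟶ Y) : Prop := LeftAS P f ∧ LeftMin f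

/-- An object is indecomposable if it is nonzero and its only idempotent endomorphisms
are `0` and the identity (equivalently, it is not a direct sum of two nonzero objects). -/
def Indec [Limits.HasZeroMorphisms C] (X : C) : Prop :=
  ¬ Limits.IsZero X ∧ ∀ e : X ⟶ X, e ≫ e = e → e = 0 ∨ e = 𝟙 X

/-- A morphism is irreducible relative to the object class `P` if it is neither a section
nor a retraction while in any factorization through an object of `P` the first factor is a
section or the second factor is a retraction. -/
def IrredOn (P : C → Prop) {X Y : C} (f : X ⟶ Y) : Prop :=
  ¬ IsSect f ∧ ¬ IsRetr f ∧
    ∀ ⦃Z : C⦄, P Z → ∀ (g : X ⟶ Z) (h : Z ⟶ Y), g ≫ h = f → IsSect g ∨ IsRetr h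

/-- An object `M` is projective relative to the object class `P`: any morphism from `M` to
the codomain of an epimorphism between objects of `P` lifts. -/
def ProjOn (P : C → Prop) (M : C) : Prop :=
  ∀ ⦃A B : C⦄, P A → P B → ∀ (g : A ⟶ B), Epi g → ∀ h : M ⟶ B, ∃ l : M ⟶ A, l ≫ g = h

/-- An object `M` is injective relative to the object class `P`: any morphism to `M` from
the domain of a monomorphism between objects of `P` extends. -/
def InjOn (P : C → Prop) (M : C) : Prop :=
  ∀ ⦃A B : C⦄, P A → P B → ∀ (g : A ⟶ B), Mono g → ∀ h : A ⟶ M, ∃ l : B ⟶ M, g ≫ l = h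

/-- An essential monomorphism, relative to the object class `P`. -/
def EssMonoOn (P : C → Prop) {X Y : C} (f : X ⟶ Y) : Prop :=
  Mono f ∧ ∀ ⦃W : C⦄, P W → ∀ g : Y ⟶ W, Mono (f ≫ g) → Mono g

/-- A superfluous epimorphism, relative to the object class `P`. -/
def SupEpiOn (P : C → Prop) {X Y : C} (f : X ⟶ Y) : Prop :=
  Epi f ∧ ∀ ⦃W : C⦄, P W → ∀ g : W ⟶ X, Epi (g ≫ f) → Epi g

end AlmostSplit

section Derived

variable (H : Type uC) [Category.{vC} H] [Abelian H] [HasDerivedCategory.{w} H]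

/-- An object of the derived category belongs to the bounded derived category `D^b(H)`
if its homology is concentrated in finitely many degrees. -/
def BddObj (X : DerivedCategory H) : Prop :=
  ∃ a b : ℤ, ∀ n : ℤ, (n < a ∨ b < n) →
    IsZero ((DerivedCategory.homologyFunctor H n).obj X)

/-- An almost split triangle in the bounded derived category `D^b(H)`: a distinguished
triangle with bounded vertices whose first morphism is minimal left almost split and whose
second morphism is minimal right almost split (relative to the bounded objects). -/
def IsASTriangle (T : Triangle (DerivedCategory H)) : Prop :=
  (T ∈ distTriang (DerivedCategory H)) ∧
    BddObj H T.obj₁ ∧ BddObj H T.obj₂ ∧ BddObj H T.obj₃ ∧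
    MinLeftAS (BddObj H) T.mor₁ ∧ MinRightAS (BddObj H) T.mor₂

variable {H}

/-- An almost split sequence in the abelian category `H`. -/
def IsASSeq (S : ShortComplex H) : Prop :=
  S.ShortExact ∧ MinLeftAS (fun _ => True) S.f ∧ MinRightAS (fun _ => True) S.g

variable (H)

/-- A "connecting" triangle `I → (I/S) ⊕ (rad P)[1] → P[1] → I[1]` in `D^b(H)` attached
to a simple object `S` of `H` admitting a projective cover `ε : P → S` (so
`rad P = ker ε`) and an injective hull `ι : S → I` (so `I/S = coker ι`). -/
def IsConnectingTriangle (T : Triangle (DerivedCategory H)) : Prop :=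
  ∃ (S₀ P I : H) (ε : P ⟶ S₀) (ι : S₀ ⟶ I), Simple S₀ ∧
    Projective P ∧ SupEpiOn (fun _ => True) ε ∧
    Injective I ∧ EssMonoOn (fun _ => True) ι ∧
    ∃ (g : (DerivedCategory.singleFunctor H 0).obj I ⟶
        ((DerivedCategory.singleFunctor H 0).obj (cokernel ι)) ⊞
          (((DerivedCategory.singleFunctor H 0).obj (kernel ε))⟦(1 : ℤ)⟧))
      (h : ((DerivedCategory.singleFunctor H 0).obj (cokernel ι)) ⊞
          (((DerivedCategory.singleFunctor H 0).obj (kernel ε))⟦(1 : ℤ)⟧) ⟶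
            ((DerivedCategory.singleFunctor H 0).obj P)⟦(1 : ℤ)⟧)
      (δ : ((DerivedCategory.singleFunctor H 0).obj P)⟦(1 : ℤ)⟧ ⟶
        ((DerivedCategory.singleFunctor H 0).obj I)⟦(1 : ℤ)⟧),
      Nonempty (T ≅ Triangle.mk g h δ)

end Derived


set_option linter.unusedSectionVars false

section ASGeneral

universe uD vD
variable {C : Type uD} [Category.{vD} C]

lemma LeftAS.of_iso {P : C → Prop} {X Y X' Y' : C} {f : X ⟶ Y} {f' : X' ⟶ Y'}
    (hf : LeftAS P f) (a : X ≅ X') (b : Y ≅ Y') (w : f ≫ b.hom = a.hom ≫ f') : LeftAS P f' := by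
  have w' : f' ≫ b.inv = a.inv ≫ f := by
    rw [Iso.comp_inv_eq, Category.assoc, w, Iso.inv_hom_id_assoc]
  refine ⟨fun ⟨r, hr⟩ => hf.1 ⟨b.hom ≫ r ≫ a.inv, ?_⟩, fun W hW h hh => ?_⟩
  · rw [reassoc_of% w, reassoc_of% hr]; simp
  · obtain ⟨u, hu⟩ := hf.2 hW (a.hom ≫ h) (fun ⟨r, hr⟩ => hh ⟨r ≫ a.hom, by
      rw [← cancel_epi a.hom, ← Category.assoc, ← Category.assoc, Category.assoc a.hom, ]
      simp only [Category.assoc] at hr ⊢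
      rw [reassoc_of% hr]; simp⟩)
    exact ⟨b.inv ≫ u, by rw [reassoc_of% w', hu]; simp⟩

lemma RightAS.of_iso {P : C → Prop} {X Y X' Y' : C} {f : X ⟶ Y} {f' : X' ⟶ Y'}
    (hf : RightAS P f) (a : X ≅ X') (b : Y ≅ Y') (w : f ≫ b.hom = a.hom ≫ f') : RightAS P f' := by
  have w' : f' ≫ b.inv = a.inv ≫ f := by
    rw [Iso.comp_inv_eq, Category.assoc, w, Iso.inv_hom_id_assoc]
  refine ⟨fun ⟨r, hr⟩ => hf.1 ⟨b.hom ≫ r ≫ a.inv, ?_⟩, fun W hW h hh => ?_⟩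
  · simp only [Category.assoc]; rw [← w', reassoc_of% hr]; simp
  · obtain ⟨u, hu⟩ := hf.2 hW (h ≫ b.inv) (fun ⟨r, hr⟩ => hh ⟨b.inv ≫ r, by
      rw [← cancel_mono b.inv]; simp only [Category.assoc]; rw [hr]; simp⟩)
    exact ⟨u ≫ a.hom, by rw [Category.assoc, ← w, reassoc_of% hu]; simp⟩

lemma LeftAS.indec [Preadditive C] {P : C → Prop} {X Y : C} {f : X ⟶ Y} (hf : LeftAS P f)
    (hX : P X) : Indec X := by
  have key : ∀ e : X ⟶ X, e ≫ e = e → IsSect e → e = 𝟙 X := by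
    rintro e he ⟨s, hs⟩
    calc e = e ≫ (e ≫ s) := by rw [hs, Category.comp_id]
      _ = 𝟙 X := by rw [← Category.assoc, he, hs]
  refine ⟨fun h => hf.1 ⟨0, h.eq_of_src _ _⟩, fun e he => ?_⟩
  by_cases h1 : IsSect e
  · exact Or.inr (key e he h1)
  · by_cases h2 : IsSect (𝟙 X - e)
    · left
      have := key (𝟙 X - e) (by simp [he]) h2
      simpa using this
    · obtain ⟨u, hu⟩ := hf.2 hX _ h1
      obtain ⟨v, hv⟩ := hf.2 hX _ h2
      exact absurd ⟨u + v, by rw [Preadditive.comp_add, hu, hv]; simp⟩ hf.1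

lemma RightAS.indec [Preadditive C] {P : C → Prop} {X Y : C} {f : X ⟶ Y} (hf : RightAS P f)
    (hY : P Y) : Indec Y := by
  have key : ∀ e : Y ⟶ Y, e ≫ e = e → IsRetr e → e = 𝟙 Y := by
    rintro e he ⟨s, hs⟩
    calc e = (s ≫ e) ≫ e := by rw [hs, Category.id_comp]
      _ = 𝟙 Y := by rw [Category.assoc, he, hs]
  refine ⟨fun h => hf.1 ⟨0, h.eq_of_src _ _⟩, fun e he => ?_⟩
  by_cases h1 : IsRetr e
  · exact Or.inr (key e he h1)
  · by_cases h2 : IsRetr (𝟙 Y - e)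
    · left
      have := key (𝟙 Y - e) (by simp [he]) h2
      simpa using this
    · obtain ⟨u, hu⟩ := hf.2 hY _ h1
      obtain ⟨v, hv⟩ := hf.2 hY _ h2
      exact absurd ⟨u + v, by rw [Preadditive.add_comp, hu, hv]; simp⟩ hf.1

lemma LeftAS.neg [Preadditive C] {P : C → Prop} {X Y : C} {f : X ⟶ Y} (hf : LeftAS P f) : LeftAS P (-f) :=
  hf.of_iso (Iso.refl _) ⟨-𝟙 _, -𝟙 _, by simp, by simp⟩ (by simp)

lemma RightAS.neg [Preadditive C] {P : C → Prop} {X Y : C} {f : X ⟶ Y} (hf : RightAS P f) : RightAS P (-f) :=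
  hf.of_iso (Iso.refl _) ⟨-𝟙 _, -𝟙 _, by simp, by simp⟩ (by simp)

variable [Preadditive C] [HasZeroObject C] [HasShift C ℤ]
  [∀ n : ℤ, (shiftFunctor C n).Additive] [Pretriangulated C]

lemma mor3_ne_zero_of_not_retr {T : Triangle C} (hT : T ∈ distTriang C)
    (h : ¬ IsRetr T.mor₂) : T.mor₃ ≠ 0 := fun h0 => by
  obtain ⟨s, hs⟩ := Triangle.coyoneda_exact₃ T hT (𝟙 _) (by rw [h0, comp_zero])
  exact h ⟨s, hs.symm⟩

lemma not_retr_of_mor3_ne_zero {T : Triangle C} (hT : T ∈ distTriang C)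
    (h : T.mor₃ ≠ 0) : ¬ IsRetr T.mor₂ := fun ⟨s, hs⟩ => h (by
  rw [← Category.id_comp T.mor₃, ← hs, Category.assoc, comp_distTriang_mor_zero₂₃ _ hT, comp_zero])

lemma not_sect_of_mor3_ne_zero {T : Triangle C} (hT : T ∈ distTriang C)
    (h : T.mor₃ ≠ 0) : ¬ IsSect T.mor₁ := fun ⟨s, hs⟩ => h (by
  have h1 := comp_distTriang_mor_zero₃₁ _ hT
  rw [← Category.comp_id T.mor₃, ← CategoryTheory.Functor.map_id, ← hs, Functor.map_comp, reassoc_of% h1, zero_comp])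

lemma rightAS_of_mor3 {P : C → Prop} {T : Triangle C} (hT : T ∈ distTriang C)
    (h : T.mor₃ ≠ 0) (h2 : ∀ W, P W → ∀ t : W ⟶ T.obj₃, ¬ IsRetr t → t ≫ T.mor₃ = 0) :
    RightAS P T.mor₂ :=
  ⟨not_retr_of_mor3_ne_zero hT h, fun W hW t ht => by
    obtain ⟨u, hu⟩ := Triangle.coyoneda_exact₃ T hT t (h2 W hW t ht)
    exact ⟨u, hu.symm⟩⟩

lemma leftAS_of_mor3 {P : C → Prop} {T : Triangle C} (hT : T ∈ distTriang C)
    (h : T.mor₃ ≠ 0) (h2 : ∀ W, P W → ∀ t : T.obj₁ ⟶ W, ¬ IsSect t → T.mor₃ ≫ t⟦(1:ℤ)⟧' = 0) :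
    LeftAS P T.mor₁ :=
  ⟨not_sect_of_mor3_ne_zero hT h, fun W hW t ht => by
    obtain ⟨u, hu⟩ := Triangle.yoneda_exact₃ _ (rot_of_distTriang _ hT) (t⟦(1:ℤ)⟧') (h2 W hW t ht)
    change T.obj₂⟦(1:ℤ)⟧ ⟶ W⟦(1:ℤ)⟧ at u
    obtain ⟨v, rfl⟩ := (shiftFunctor C (1:ℤ)).map_surjective u
    change t⟦(1:ℤ)⟧' = (-T.mor₁⟦(1:ℤ)⟧') ≫ _ at hu
    refine ⟨-v, (shiftFunctor C (1:ℤ)).map_injective ?_⟩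
    rw [hu, Functor.map_comp, Functor.map_neg]
    rw [Preadditive.neg_comp, Preadditive.comp_neg]⟩

lemma RightAS.comp_mor3 {P : C → Prop} {T : Triangle C} (hT : T ∈ distTriang C)
    (h : RightAS P T.mor₂) {W : C} (hW : P W) (t : W ⟶ T.obj₃) (ht : ¬ IsRetr t) :
    t ≫ T.mor₃ = 0 := by
  obtain ⟨u, rfl⟩ := h.2 hW t ht
  rw [Category.assoc, comp_distTriang_mor_zero₂₃ _ hT, comp_zero]

lemma LeftAS.mor3_comp {P : C → Prop} {T : Triangle C} (hT : T ∈ distTriang C)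
    (h : LeftAS P T.mor₁) {W : C} (hW : P W) (t : T.obj₁ ⟶ W) (ht : ¬ IsSect t) :
    T.mor₃ ≫ t⟦(1:ℤ)⟧' = 0 := by
  obtain ⟨u, rfl⟩ := h.2 hW t ht
  have h1 := comp_distTriang_mor_zero₃₁ _ hT
  rw [Functor.map_comp, reassoc_of% h1, zero_comp]

lemma rightMin_of_AS {P : C → Prop} {T : Triangle C} (hT : T ∈ distTriang C)
    (hX : P T.obj₁) (hf : LeftAS P T.mor₁) (hg : RightAS P T.mor₂) : RightMin T.mor₂ := by
  have h0 := mor3_ne_zero_of_not_retr hT hg.1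
  have sect : ∀ a : T.obj₁ ⟶ T.obj₁, T.mor₃ ≫ a⟦(1:ℤ)⟧' = T.mor₃ → IsSect a := by
    intro a ha
    by_contra hn
    exact h0 (by rw [← ha]; exact hf.mor3_comp hT hX a hn)
  intro u hu
  obtain ⟨a, ha1, ha2⟩ := complete_distinguished_triangle_morphism₁ T T hT hT u (𝟙 _)
    (by rw [hu, Category.comp_id])
  rw [Category.id_comp] at ha2
  obtain ⟨r, hr⟩ := sect a ha2
  have hr2 : T.mor₃ ≫ r⟦(1:ℤ)⟧' = T.mor₃ := by
    conv_lhs => rw [← ha2]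
    rw [Category.assoc, ← Functor.map_comp, hr, CategoryTheory.Functor.map_id, Category.comp_id]
  obtain ⟨s, hs⟩ := sect r hr2
  have hsa : s = a := by
    calc s = (a ≫ r) ≫ s := by rw [hr, Category.id_comp]
      _ = a := by rw [Category.assoc, hs, Category.comp_id]
  have : IsIso a := ⟨r, hr, by rw [← hsa, hs]⟩
  exact isIso₂_of_isIso₁₃ (Triangle.homMk T T a u (𝟙 _) ha1 (by simp [hu])
    (by simp [ha2])) hT hT (by simpa) (IsIso.id _)

lemma leftMin_of_AS {P : C → Prop} {T : Triangle C} (hT : T ∈ distTriang C)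
    (hZ : P T.obj₃) (hg : RightAS P T.mor₂) : LeftMin T.mor₁ := by
  have h0 := mor3_ne_zero_of_not_retr hT hg.1
  have sect : ∀ a : T.obj₃ ⟶ T.obj₃, a ≫ T.mor₃ = T.mor₃ → IsRetr a := by
    intro a ha
    by_contra hn
    exact h0 (by rw [← ha]; exact hg.comp_mor3 hT hZ a hn)
  intro u hu
  obtain ⟨a, ha1, ha2⟩ := complete_distinguished_triangle_morphism T T hT hT (𝟙 _) u
    (by rw [hu, Category.id_comp])
  rw [CategoryTheory.Functor.map_id, Category.comp_id] at ha2
  replace ha2 := ha2.symm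
  obtain ⟨r, hr⟩ := sect a ha2
  have hr2 : r ≫ T.mor₃ = T.mor₃ := by
    conv_lhs => rw [← ha2]
    rw [← Category.assoc, hr, Category.id_comp]
  obtain ⟨s, hs⟩ := sect r hr2
  have hsa : s = a := by
    calc s = s ≫ (r ≫ a) := by rw [hr, Category.comp_id]
      _ = a := by rw [← Category.assoc, hs, Category.id_comp]
  have : IsIso a := ⟨r, by rw [← hsa, hs], hr⟩
  exact isIso₂_of_isIso₁₃ (Triangle.homMk T T (𝟙 _) u a (by simp [hu]) ha1
    (by simp [ha2])) hT hT (IsIso.id _) (by simpa)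

lemma LeftAS.shift {P : C → Prop} (hP : ∀ X (n : ℤ), P X → P (X⟦n⟧)) {X Y : C} {f : X ⟶ Y}
    (hf : LeftAS P f) (n : ℤ) : LeftAS P (f⟦n⟧') := by
  refine ⟨fun ⟨r, hr⟩ => ?_, fun W hW h hh => ?_⟩
  · obtain ⟨r, rfl⟩ := (shiftFunctor C n).map_surjective r
    exact hf.1 ⟨r, (shiftFunctor C n).map_injective (by simpa using hr)⟩
  · let e : W⟦-n⟧⟦n⟧ ≅ W := (shiftEquiv C n).counitIso.app W
    obtain ⟨k, hk⟩ := (shiftFunctor C n).map_surjective (h ≫ e.inv)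
    obtain ⟨u, hu⟩ := hf.2 (hP W (-n) hW) k (fun ⟨r, hr⟩ => hh ⟨e.inv ≫ r⟦n⟧', by
      rw [← Category.assoc, ← hk, ← Functor.map_comp, hr, CategoryTheory.Functor.map_id]⟩)
    exact ⟨u⟦n⟧' ≫ e.hom, by rw [← Category.assoc, ← Functor.map_comp, hu, hk]; simp⟩

lemma RightAS.shift {P : C → Prop} (hP : ∀ X (n : ℤ), P X → P (X⟦n⟧)) {X Y : C} {f : X ⟶ Y}
    (hf : RightAS P f) (n : ℤ) : RightAS P (f⟦n⟧') := by
  refine ⟨fun ⟨r, hr⟩ => ?_, fun W hW h hh => ?_⟩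
  · obtain ⟨r, rfl⟩ := (shiftFunctor C n).map_surjective r
    exact hf.1 ⟨r, (shiftFunctor C n).map_injective (by simpa using hr)⟩
  · let e : W⟦-n⟧⟦n⟧ ≅ W := (shiftEquiv C n).counitIso.app W
    obtain ⟨k, hk⟩ := (shiftFunctor C n).map_surjective (e.hom ≫ h)
    obtain ⟨u, hu⟩ := hf.2 (hP W (-n) hW) k (fun ⟨r, hr⟩ => hh ⟨r⟦n⟧' ≫ e.hom, by
      rw [Category.assoc, ← hk, ← Functor.map_comp, hr, CategoryTheory.Functor.map_id]⟩)
    exact ⟨e.inv ≫ u⟦n⟧', by rw [Category.assoc, ← Functor.map_comp, hu, hk]; simp⟩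

section Mk

variable {X Y Z W : C} {f : X ⟶ Y} {g : Y ⟶ Z} {h : Z ⟶ X⟦(1:ℤ)⟧}

lemma mk_yoneda₂ (hT : Triangle.mk f g h ∈ distTriang C)
    (k : Y ⟶ W) (hk : f ≫ k = 0) : ∃ u : Z ⟶ W, k = g ≫ u :=
  Triangle.yoneda_exact₂ _ hT k hk

lemma mk_yoneda₃ (hT : Triangle.mk f g h ∈ distTriang C)
    (k : Z ⟶ W) (hk : g ≫ k = 0) : ∃ u : X⟦(1:ℤ)⟧ ⟶ W, k = h ≫ u :=
  Triangle.yoneda_exact₃ _ hT k hk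

lemma mk_coyoneda₂ (hT : Triangle.mk f g h ∈ distTriang C)
    (k : W ⟶ Y) (hk : k ≫ g = 0) : ∃ u : W ⟶ X, k = u ≫ f :=
  Triangle.coyoneda_exact₂ _ hT k hk

lemma mk_coyoneda₃ (hT : Triangle.mk f g h ∈ distTriang C)
    (k : W ⟶ Z) (hk : k ≫ h = 0) : ∃ u : W ⟶ Y, k = u ≫ g :=
  Triangle.coyoneda_exact₃ _ hT k hk

lemma mk_coyoneda₁ (hT : Triangle.mk f g h ∈ distTriang C)
    (k : W ⟶ X⟦(1:ℤ)⟧) (hk : k ≫ f⟦(1:ℤ)⟧' = 0) : ∃ u : W ⟶ Z, k = u ≫ h :=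
  Triangle.coyoneda_exact₁ _ hT k hk

lemma mk_yoneda₁ (hT : Triangle.mk f g h ∈ distTriang C)
    (k : X ⟶ W) (hk : h ≫ k⟦(1:ℤ)⟧' = 0) : ∃ u : Y ⟶ W, k = f ≫ u := by
  obtain ⟨u, hu⟩ := Triangle.yoneda_exact₃ _ (rot_of_distTriang _ hT) (k⟦(1:ℤ)⟧') hk
  change Y⟦(1:ℤ)⟧ ⟶ W⟦(1:ℤ)⟧ at u
  obtain ⟨v, rfl⟩ := (shiftFunctor C (1:ℤ)).map_surjective u
  change k⟦(1:ℤ)⟧' = (-f⟦(1:ℤ)⟧') ≫ _ at hu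
  refine ⟨-v, (shiftFunctor C (1:ℤ)).map_injective ?_⟩
  rw [hu, Functor.map_comp, Functor.map_neg]
  rw [Preadditive.neg_comp, Preadditive.comp_neg]

lemma mk_zero₁₂ (hT : Triangle.mk f g h ∈ distTriang C) : f ≫ g = 0 := comp_distTriang_mor_zero₁₂ _ hT

lemma mk_zero₂₃ (hT : Triangle.mk f g h ∈ distTriang C) : g ≫ h = 0 := comp_distTriang_mor_zero₂₃ _ hT

lemma mk_zero₃₁ (hT : Triangle.mk f g h ∈ distTriang C) : h ≫ f⟦(1:ℤ)⟧' = 0 := comp_distTriang_mor_zero₃₁ _ hT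

end Mk

end ASGeneral

section Vanishing

variable {H : Type uC} [Category.{vC} H] [Abelian H]

lemma epi_f_zero_of_quasiIso {K : CochainComplex H ℤ} (X : H)
    (s : K ⟶ (HomologicalComplex.single H (ComplexShape.up ℤ) 0).obj X) [QuasiIso s] :
    Epi (s.f 0) := by
  let L := (HomologicalComplex.single H (ComplexShape.up ℤ) 0).obj X
  have h1 : IsIso (L.iCycles 0) := L.isIso_iCycles 0 1 (by simp) (by simp [L])
  have h2 : IsIso (L.homologyπ 0) := L.isIso_homologyπ (-1) 0 (by simp) (by simp [L])
  have h3 := HomologicalComplex.homologyπ_naturality s 0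
  have h4 := HomologicalComplex.cyclesMap_i s 0
  have h5 : Epi (HomologicalComplex.cyclesMap s 0 ≫ L.homologyπ 0) := by
    rw [← h3]
    infer_instance
  have h6 : Epi (HomologicalComplex.cyclesMap s 0) := by
    have := epi_comp (HomologicalComplex.cyclesMap s 0 ≫ L.homologyπ 0) (inv (L.homologyπ 0))
    simpa using this
  have h7 : Epi (K.iCycles 0 ≫ s.f 0) := by
    rw [← h4]
    infer_instance
  exact epi_of_epi (K.iCycles 0) _

variable [HasDerivedCategory.{w} H]

lemma effacement {X : H} {B : DerivedCategory H} [hB : B.IsLE (-1)]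
    (f : (DerivedCategory.singleFunctor H 0).obj X ⟶ B) :
    ∃ (X' : H) (p : X' ⟶ X), Epi p ∧ (DerivedCategory.singleFunctor H 0).map p ≫ f = 0 := by
  obtain ⟨L, hL, ⟨e⟩⟩ := DerivedCategory.exists_iso_Q_obj_of_isLE B (-1)
  let σ := DerivedCategory.singleFunctorIsoCompQ H 0
  let X₀ := (HomologicalComplex.single H (ComplexShape.up ℤ) 0).obj X
  obtain ⟨K, hK, s, hs, g, hg⟩ := DerivedCategory.right_fac_of_isStrictlyLE
    (X := X₀) (Y := L) (σ.inv.app X ≫ f ≫ e.hom) 0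
  have hs' : QuasiIso s := by
    rwa [DerivedCategory.isIso_Q_map_iff_quasiIso] at hs
  have hepi := epi_f_zero_of_quasiIso X s
  let j : (HomologicalComplex.single H (ComplexShape.up ℤ) 0).obj (K.X 0) ⟶ K :=
    HomologicalComplex.mkHomFromSingle (𝟙 _) (fun k hk =>
      (K.isZero_of_isStrictlyLE 0 k (by simp at hk; omega)).eq_of_tgt _ _)
  let p : K.X 0 ⟶ X := s.f 0 ≫ (HomologicalComplex.singleObjXSelf _ 0 X).hom
  have hj : j ≫ s = (HomologicalComplex.single H (ComplexShape.up ℤ) 0).map p := by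
    apply HomologicalComplex.from_single_hom_ext
    simp [j, p, HomologicalComplex.single_map_f_self]
  have hjg : j ≫ g = 0 := by
    apply HomologicalComplex.from_single_hom_ext
    exact (L.isZero_of_isStrictlyLE (-1) 0 (by omega)).eq_of_tgt _ _
  refine ⟨K.X 0, p, epi_comp _ _, ?_⟩
  have h1 : DerivedCategory.Q.map s ≫ σ.inv.app X ≫ f ≫ e.hom = DerivedCategory.Q.map g := by
    rw [hg]; simp
  have h2 : DerivedCategory.Q.map ((HomologicalComplex.single H (ComplexShape.up ℤ) 0).map p)
      ≫ σ.inv.app X ≫ f ≫ e.hom = 0 := by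
    rw [← hj, Functor.map_comp, Category.assoc, h1, ← Functor.map_comp, hjg, Functor.map_zero]
  have h3 : σ.inv.app (K.X 0) ≫ (DerivedCategory.singleFunctor H 0).map p =
    DerivedCategory.Q.map ((HomologicalComplex.single H (ComplexShape.up ℤ) 0).map p)
      ≫ σ.inv.app X := (σ.inv.naturality p).symm
  rw [← cancel_epi (σ.inv.app (K.X 0)), ← cancel_mono e.hom, Category.assoc, Category.assoc,
    reassoc_of% h3]
  exact (Category.assoc _ _ _).trans (h2.trans (by rw [comp_zero]; exact zero_comp.symm))

open DerivedCategory

/-- No nonzero morphisms. -/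
def Orth {D : Type*} [Category D] [HasZeroMorphisms D] (A B : D) : Prop := ∀ f : A ⟶ B, f = 0

lemma Orth.of_iso {D : Type*} [Category D] [HasZeroMorphisms D] {A B A' B' : D}
    (h : Orth A B) (e : A ≅ A') (e' : B ≅ B') : Orth A' B' := fun f => by
  have := h (e.hom ≫ f ≫ e'.inv)
  rwa [← cancel_epi e.hom, ← cancel_mono e'.inv, Category.assoc, comp_zero, zero_comp]

lemma Orth.shift {A B : DerivedCategory H} (h : Orth A B) (n : ℤ) : Orth (A⟦n⟧) (B⟦n⟧) :=
  fun f => by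
    obtain ⟨g, rfl⟩ := (shiftFunctor _ n).map_surjective f
    rw [h g, Functor.map_zero]

lemma Orth.of_shift {A B : DerivedCategory H} (n : ℤ) (h : Orth (A⟦n⟧) (B⟦n⟧)) : Orth A B :=
  fun _ => (shiftFunctor _ n).map_injective ((h _).trans (h _).symm)

lemma Orth.ext_left {T : Triangle (DerivedCategory H)} (hT : T ∈ distTriang _)
    {B : DerivedCategory H} (h1 : Orth T.obj₁ B) (h3 : Orth T.obj₃ B) : Orth T.obj₂ B := fun f => by
  obtain ⟨g, rfl⟩ := Triangle.yoneda_exact₂ T hT f (h1 _)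
  rw [h3 g, comp_zero]

lemma Orth.ext_right {T : Triangle (DerivedCategory H)} (hT : T ∈ distTriang _)
    {B : DerivedCategory H} (h1 : Orth B T.obj₁) (h3 : Orth B T.obj₃) : Orth B T.obj₂ := fun f => by
  obtain ⟨g, rfl⟩ := Triangle.coyoneda_exact₂ T hT f (h3 _)
  rw [h1 g, zero_comp]

lemma exists_trunc (X : DerivedCategory H) (n : ℤ) :
    ∃ (A B : DerivedCategory H) (i : A ⟶ X) (p : X ⟶ B) (δ : B ⟶ A⟦(1:ℤ)⟧),
      Triangle.mk i p δ ∈ distTriang _ ∧ A.IsLE n ∧ B.IsGE (n + 1) ∧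
      (∀ a, X.IsGE a → A.IsGE a ∧ B.IsGE a) ∧ (∀ b, X.IsLE b → A.IsLE b ∧ B.IsLE b) :=
  ⟨_, _, _, _, _, TStructure.t.triangleLEGT_distinguished n X, inferInstance, inferInstance,
    fun _ _ => ⟨inferInstance, inferInstance⟩, fun _ _ => ⟨inferInstance, inferInstance⟩⟩

lemma bdd_iff (X : DerivedCategory H) : BddObj H X ↔ ∃ a b, X.IsGE a ∧ X.IsLE b := by
  simp only [isGE_iff, isLE_iff]
  exact ⟨fun ⟨a, b, h⟩ => ⟨a, b, fun i hi => h i (Or.inl hi), fun i hi => h i (Or.inr hi)⟩,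
    fun ⟨a, b, h1, h2⟩ => ⟨a, b, fun i hi => hi.elim (h1 i) (h2 i)⟩⟩

lemma shift_ge {X : DerivedCategory H} {n : ℤ} (hX : X.IsGE n) (a m : ℤ) (h : a + m = n) :
    (X⟦a⟧).IsGE m := TStructure.t.isGE_shift X n a m h

lemma shift_le {X : DerivedCategory H} {n : ℤ} (hX : X.IsLE n) (a m : ℤ) (h : a + m = n) :
    (X⟦a⟧).IsLE m := TStructure.t.isLE_shift X n a m h

lemma mono_ge {X : DerivedCategory H} {n : ℤ} (hX : X.IsGE n) {m : ℤ} (h : m ≤ n) : X.IsGE m :=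
  TStructure.t.isGE_of_ge X m n h

lemma mono_le {X : DerivedCategory H} {n : ℤ} (hX : X.IsLE n) {m : ℤ} (h : n ≤ m) : X.IsLE m :=
  TStructure.t.isLE_of_le X n m h

lemma BddObj.shift {X : DerivedCategory H} (h : BddObj H X) (n : ℤ) : BddObj H (X⟦n⟧) := by
  rw [bdd_iff] at h ⊢
  obtain ⟨a, b, h1, h2⟩ := h
  exact ⟨a - n, b - n, shift_ge h1 n _ (by omega), shift_le h2 n _ (by omega)⟩

lemma BddObj.of_iso {X Y : DerivedCategory H} (h : BddObj H X) (e : X ≅ Y) : BddObj H Y := by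
  rw [bdd_iff] at h ⊢
  obtain ⟨a, b, h1, h2⟩ := h
  exact ⟨a, b, TStructure.t.isGE_of_iso e a, TStructure.t.isLE_of_iso e b⟩

lemma bdd_single (X : H) : BddObj H ((singleFunctor H 0).obj X) :=
  (bdd_iff _).2 ⟨0, 0, inferInstance, inferInstance⟩

lemma BddObj.ext₂ {T : Triangle (DerivedCategory H)} (hT : T ∈ distTriang _)
    (h1 : BddObj H T.obj₁) (h3 : BddObj H T.obj₃) : BddObj H T.obj₂ := by
  rw [bdd_iff] at *
  obtain ⟨a, b, h1, h2⟩ := h1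
  obtain ⟨a', b', h1', h2'⟩ := h3
  exact ⟨min a a', max b b',
    TStructure.t.isGE₂ T hT _ (mono_ge h1 (by omega)) (mono_ge h1' (by omega)),
    TStructure.t.isLE₂ T hT _ (mono_le h2 (by omega)) (mono_le h2' (by omega))⟩

lemma stalk {X : DerivedCategory H} {n : ℤ} (h1 : X.IsGE n) (h2 : X.IsLE n) :
    ∃ Y : H, Nonempty (X ≅ ((singleFunctor H 0).obj Y)⟦-n⟧) := by
  have h1' := shift_ge h1 n 0 (by omega)
  have h2' := shift_le h2 n 0 (by omega)
  obtain ⟨Y, ⟨e⟩⟩ := exists_iso_singleFunctor_obj_of_isGE_of_isLE (X⟦n⟧) 0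
  exact ⟨Y, ⟨((shiftEquiv _ n).unitIso.app X) ≪≫ (shiftFunctor _ (-n)).mapIso e⟩⟩

lemma stalk0 {X : DerivedCategory H} (h1 : X.IsGE 0) (h2 : X.IsLE 0) :
    ∃ Y : H, Nonempty (X ≅ (singleFunctor H 0).obj Y) :=
  exists_iso_singleFunctor_obj_of_isGE_of_isLE X 0

lemma kernel_triangle {X Y : H} (p : X ⟶ Y) [hp : Epi p] :
    ∃ δ, Triangle.mk ((singleFunctor H 0).map (kernel.ι p)) ((singleFunctor H 0).map p) δ ∈
      distTriang (DerivedCategory H) := by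
  let S : ShortComplex H := ShortComplex.mk (kernel.ι p) p (by simp)
  have hS : S.ShortExact :=
    { exact := ShortComplex.exact_of_f_is_kernel _ (kernelIsKernel p)
      mono_f := inferInstanceAs (Mono (kernel.ι p))
      epi_g := hp }
  exact ⟨_, hS.singleTriangle_distinguished⟩

lemma cokernel_triangle {X Y : H} (p : X ⟶ Y) [hp : Mono p] :
    ∃ δ, Triangle.mk ((singleFunctor H 0).map p) ((singleFunctor H 0).map (cokernel.π p)) δ ∈
      distTriang (DerivedCategory H) := by
  let S : ShortComplex H := ShortComplex.mk p (cokernel.π p) (by simp)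
  have hS : S.ShortExact :=
    { exact := ShortComplex.exact_of_g_is_cokernel _ (cokernelIsCokernel p)
      mono_f := hp
      epi_g := inferInstanceAs (Epi (cokernel.π p)) }
  exact ⟨_, hS.singleTriangle_distinguished⟩

lemma orth_single_step {k : ℤ} (hk : 0 ≤ k)
    (h : ∀ X Y : H, Orth ((singleFunctor H 0).obj X) (((singleFunctor H 0).obj Y)⟦k⟧)) (X Y : H) :
    Orth ((singleFunctor H 0).obj X) (((singleFunctor H 0).obj Y)⟦k + 1⟧) := fun f => by
  have : (((singleFunctor H 0).obj Y)⟦k + 1⟧).IsLE (-1) :=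
    shift_le (n := k) (mono_le (n := 0) inferInstance hk) _ _ (by omega)
  obtain ⟨X', p, hp, hpf⟩ := effacement f
  obtain ⟨δ, hT⟩ := kernel_triangle p
  obtain ⟨g, rfl⟩ := mk_yoneda₃ hT f hpf
  have : g = 0 := ((h (kernel p) Y).shift 1).of_iso (Iso.refl _)
    ((shiftFunctorAdd _ k 1).app _).symm g
  rw [this, comp_zero]

lemma orth_single_of_hered
    (h2 : ∀ X Y : H, Orth ((singleFunctor H 0).obj X) (((singleFunctor H 0).obj Y)⟦(2:ℤ)⟧))
    (X Y : H) (k : ℤ) (hk : 2 ≤ k) :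
    Orth ((singleFunctor H 0).obj X) (((singleFunctor H 0).obj Y)⟦k⟧) := by
  induction k, hk using Int.leInduction generalizing X Y with
  | base => exact h2 X Y
  | succ k hk ih => exact orth_single_step (by omega) ih X Y

lemma orth_of_isZero_src {A B : DerivedCategory H} (h : IsZero A) : Orth A B :=
  fun _ => h.eq_of_src _ _

lemma orth_of_hered
    (h2 : ∀ X Y : H, Orth ((singleFunctor H 0).obj X) (((singleFunctor H 0).obj Y)⟦(2:ℤ)⟧))
    {A B : DerivedCategory H} (hA : BddObj H A) (hB : BddObj H B) {a b : ℤ}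
    (hA' : A.IsGE a) (hB' : B.IsLE b) (hab : b + 2 ≤ a) : Orth A B := by
  have stalks : ∀ (A B : DerivedCategory H) (a b : ℤ), A.IsGE a → A.IsLE a → B.IsGE b →
      B.IsLE b → b + 2 ≤ a → Orth A B := by
    intro A B a b hA1 hA2 hB1 hB2 hab
    obtain ⟨X, ⟨e⟩⟩ := stalk hA1 hA2
    obtain ⟨Y, ⟨e'⟩⟩ := stalk hB1 hB2
    refine Orth.of_iso ?_ e.symm e'.symm
    refine Orth.of_shift a ?_
    refine (orth_single_of_hered h2 X Y (a - b) (by omega)).of_iso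
      ((shiftEquiv _ a).counitIso.app _).symm
      ((shiftFunctorAdd' _ (-b) a (a - b) (by omega)).app _)
  have left : ∀ (n : ℕ) (A B : DerivedCategory H) (a b : ℤ), A.IsGE a → A.IsLE (a + n) →
      B.IsGE b → B.IsLE b → b + 2 ≤ a → Orth A B := by
    intro n
    induction n with
    | zero => exact fun A B a b h1 h2 => stalks A B a b h1 (by simpa using h2)
    | succ n ih =>
      intro A B a b hA1 hA2 hB1 hB2 hab
      obtain ⟨A', A'', i, p, δ, hT, h1, h3, h4, h5⟩ := exists_trunc A a
      exact Orth.ext_left hT (stalks A' B a b (h4 _ hA1).1 h1 hB1 hB2 hab)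
        (ih A'' B (a + 1) b h3 (mono_le (h5 _ hA2).2 (by push_cast; omega)) hB1 hB2 (by omega))
  have right : ∀ (n : ℕ) (m : ℕ) (A B : DerivedCategory H) (a b : ℤ), A.IsGE a → A.IsLE (a + m) →
      B.IsGE (b - n) → B.IsLE b → b + 2 ≤ a → Orth A B := by
    intro n
    induction n with
    | zero => exact fun m A B a b h1 h2 h3 => left m A B a b h1 h2 (by simpa using h3)
    | succ n ih =>
      intro m A B a b hA1 hA2 hB1 hB2 hab
      obtain ⟨B', B'', i, p, δ, hT, h1, h3, h4, h5⟩ := exists_trunc B (b - 1)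
      refine Orth.ext_right hT (ih m A B' a (b - 1) hA1 hA2 (mono_ge (h4 _ hB1).1
        (by push_cast; omega)) h1 (by omega)) (left m A B'' a b hA1 hA2 (mono_ge h3 (by omega))
          (h5 _ hB2).2 hab)
  rw [bdd_iff] at hA hB
  obtain ⟨a1, a2, -, hA⟩ := hA
  obtain ⟨b1, b2, hB, -⟩ := hB
  exact right (b - b1).toNat (a2 - a).toNat A B a b hA' (mono_le hA (by omega))
    (mono_ge hB (by omega)) hB' hab

lemma orth_proj {P : H} (hP : Projective P) {B : DerivedCategory H} (hB : B.IsLE (-1)) :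
    Orth ((singleFunctor H 0).obj P) B := fun f => by
  obtain ⟨X', p, hp, hpf⟩ := effacement f
  rw [← Category.id_comp f, ← CategoryTheory.Functor.map_id, ← Projective.factorThru_comp (𝟙 P) p,
    Functor.map_comp, Category.assoc, hpf, comp_zero]

lemma orth_inj (h2 : ∀ X Y : H, Orth ((singleFunctor H 0).obj X)
      (((singleFunctor H 0).obj Y)⟦(2:ℤ)⟧))
    {I : H} (hI : Injective I) {A : DerivedCategory H} (hA : BddObj H A) (hA' : A.IsGE 1) :
    Orth A ((singleFunctor H 0).obj I) := by
  have h1 : ∀ X : H, Orth ((singleFunctor H 0).obj X) (((singleFunctor H 0).obj I)⟦(1:ℤ)⟧) := by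
    intro X f
    have : (((singleFunctor H 0).obj I)⟦(1:ℤ)⟧).IsLE (-1) :=
      shift_le (n := 0) inferInstance _ _ (by omega)
    obtain ⟨X', p, hp, hpf⟩ := effacement f
    obtain ⟨δ, hT⟩ := kernel_triangle p
    obtain ⟨g, rfl⟩ := mk_yoneda₃ hT f hpf
    obtain ⟨g, rfl⟩ := (shiftFunctor _ (1:ℤ)).map_surjective g
    obtain ⟨g, rfl⟩ := (singleFunctor H 0).map_surjective g
    have hg : g = kernel.ι p ≫ Injective.factorThru g (kernel.ι p) := by simp
    have hz := mk_zero₃₁ hT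
    rw [hg, Functor.map_comp, Functor.map_comp, ← Category.assoc]
    rw [hz, zero_comp]
  obtain ⟨A', A'', i, p, δ, hT, h1', h3, h4, h5⟩ := exists_trunc A 1
  rw [bdd_iff] at hA
  obtain ⟨a, b, ha, hb⟩ := hA
  refine Orth.ext_left hT ?_ (orth_of_hered h2 ((bdd_iff _).2 ⟨a, b, (h4 _ ha).2, (h5 _ hb).2⟩)
    (bdd_single I) h3 (inferInstance : ((singleFunctor H 0).obj I).IsLE 0) (by omega))
  obtain ⟨X, ⟨e⟩⟩ := stalk (h4 _ hA').1 h1'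
  refine Orth.of_iso (Orth.of_shift 1 ?_) e.symm (Iso.refl _)
  exact (h1 X).of_iso ((shiftEquiv _ (1:ℤ)).counitIso.app _).symm (Iso.refl _)

lemma hered_orth [HasExt.{w} H] (hHered : ∀ (X Y : H) (e : CategoryTheory.Abelian.Ext X Y 2), e = 0)
    (X Y : H) : Orth ((singleFunctor H 0).obj X) (((singleFunctor H 0).obj Y)⟦(2:ℤ)⟧) := fun f => by
  let E := Abelian.Ext.homEquiv (C := H) (X := X) (Y := Y) (n := 2)
  have hE : E.symm f = E.symm 0 := by rw [hHered X Y (E.symm f), hHered X Y (E.symm 0)]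
  exact E.symm.injective hE

end Vanishing

section Transfer

variable {H : Type uC} [Category.{vC} H] [Abelian H] [HasDerivedCategory.{w} H]

open DerivedCategory

lemma zero_le_ge {A B : DerivedCategory H} {a b : ℤ} (hA : A.IsLE a) (hB : B.IsGE b) (h : a < b) :
    Orth A B := fun f => TStructure.t.zero f a b h

lemma single_ge (X : H) : ((singleFunctor H 0).obj X).IsGE 0 := inferInstance
lemma single_le (X : H) : ((singleFunctor H 0).obj X).IsLE 0 := inferInstance

lemma exists_trunc_bdd {X : DerivedCategory H} (hX : BddObj H X) (n : ℤ) :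
    ∃ (A B : DerivedCategory H) (i : A ⟶ X) (p : X ⟶ B) (δ : B ⟶ A⟦(1:ℤ)⟧),
      Triangle.mk i p δ ∈ distTriang _ ∧ A.IsLE n ∧ B.IsGE (n + 1) ∧ BddObj H A ∧ BddObj H B ∧
      (∀ a, X.IsGE a → A.IsGE a ∧ B.IsGE a) ∧ (∀ b, X.IsLE b → A.IsLE b ∧ B.IsLE b) := by
  obtain ⟨A, B, i, p, δ, hT, h1, h2, h3, h4⟩ := exists_trunc X n
  obtain ⟨a, b, ha, hb⟩ := (bdd_iff _).1 hX
  exact ⟨A, B, i, p, δ, hT, h1, h2, (bdd_iff _).2 ⟨a, b, (h3 a ha).1, (h4 b hb).1⟩,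
    (bdd_iff _).2 ⟨a, b, (h3 a ha).2, (h4 b hb).2⟩, h3, h4⟩

lemma lemmaR (h2 : ∀ X Y : H, Orth ((singleFunctor H 0).obj X) (((singleFunctor H 0).obj Y)⟦(2:ℤ)⟧))
    {Z : H} {B : DerivedCategory H} (h : (singleFunctor H 0).obj Z ⟶ B)
    (ha : ∀ R, BddObj H R → R.IsGE 1 → Orth R B)
    (hb : ∀ (M : H) (t : M ⟶ Z), ¬ IsRetr t → (singleFunctor H 0).map t ≫ h = 0)
    {W : DerivedCategory H} (hW : BddObj H W) (t : W ⟶ (singleFunctor H 0).obj Z)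
    (ht : ¬ IsRetr t) : t ≫ h = 0 := by
  obtain ⟨A, R, i, p, δ, hT, hA, hR, bA, bR, -, -⟩ := exists_trunc_bdd hW 0
  obtain ⟨N, M', j, q, δ', hT', hN, hM, bN, bM, -, hM2⟩ := exists_trunc_bdd bA (-1)
  obtain ⟨M, ⟨e⟩⟩ := stalk0 (X := M') (by simpa using hM) (hM2 _ hA).2
  obtain ⟨u, hu⟩ := mk_yoneda₂ hT' (i ≫ t) (zero_le_ge hN (single_ge Z) (by omega) _)
  obtain ⟨t0, ht0⟩ := (singleFunctor H 0).map_surjective (e.inv ≫ u)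
  have hu' : i ≫ t = q ≫ e.hom ≫ (singleFunctor H 0).map t0 := by rw [ht0, hu]; simp
  by_cases hr : IsRetr t0
  · obtain ⟨s0, hs0⟩ := hr
    exfalso
    obtain ⟨v, hv⟩ := mk_coyoneda₃ hT' ((singleFunctor H 0).map s0 ≫ e.inv)
      (orth_of_hered h2 (bdd_single Z) (bN.shift 1) (single_ge Z)
        (shift_le hN 1 (-2) (by omega)) (by omega) _)
    refine ht ⟨v ≫ i, ?_⟩
    rw [Category.assoc, hu', ← Category.assoc, ← hv]
    simp [← Functor.map_comp, hs0]
  · obtain ⟨k, hk⟩ := mk_yoneda₂ hT (t ≫ h) (by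
      rw [← Category.assoc, hu']; simp [hb M t0 hr])
    rw [hk, ha R bR (by simpa using hR) k, comp_zero]

lemma lemmaL (h2 : ∀ X Y : H, Orth ((singleFunctor H 0).obj X) (((singleFunctor H 0).obj Y)⟦(2:ℤ)⟧))
    {X : H} {B : DerivedCategory H} (h : B ⟶ (singleFunctor H 0).obj X)
    (ha : ∀ N, BddObj H N → N.IsLE (-1) → Orth B N)
    (hb : ∀ (M : H) (t : X ⟶ M), ¬ IsSect t → h ≫ (singleFunctor H 0).map t = 0)
    {W : DerivedCategory H} (hW : BddObj H W) (t : (singleFunctor H 0).obj X ⟶ W)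
    (ht : ¬ IsSect t) : h ≫ t = 0 := by
  obtain ⟨N, R, i, p, δ, hT, hN, hR, bN, bR, -, -⟩ := exists_trunc_bdd hW (-1)
  obtain ⟨A, R', j, q, δ', hT', hA, hR', bA, bR', hA2, -⟩ := exists_trunc_bdd bR 0
  obtain ⟨M, ⟨e⟩⟩ := stalk0 (X := A) (hA2 0 (by simpa using hR)).1 hA
  obtain ⟨u, hu⟩ := mk_coyoneda₂ hT' (t ≫ p) (zero_le_ge (single_le X) hR' (by omega) _)
  obtain ⟨t0, ht0⟩ := (singleFunctor H 0).map_surjective (u ≫ e.hom)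
  have hu' : t ≫ p = (singleFunctor H 0).map t0 ≫ e.inv ≫ j := by rw [ht0, hu]; simp
  by_cases hr : IsSect t0
  · obtain ⟨s0, hs0⟩ := hr
    exfalso
    obtain ⟨v, hv⟩ := mk_yoneda₁ hT' (e.hom ≫ (singleFunctor H 0).map s0)
      (orth_of_hered h2 bR' ((bdd_single X).shift 1) hR'
        (shift_le (single_le X) 1 (-1) (by omega)) (by omega) _)
    refine ht ⟨p ≫ v, ?_⟩
    rw [← Category.assoc, hu', Category.assoc, Category.assoc, ← hv]
    simp [← Functor.map_comp, hs0]
  · obtain ⟨k, hk⟩ := mk_coyoneda₂ hT (h ≫ t) (by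
      rw [Category.assoc, hu', ← Category.assoc, hb M t0 hr, zero_comp])
    rw [hk, ha N bN hN k, zero_comp]

lemma lemmaR' (h2 : ∀ X Y : H, Orth ((singleFunctor H 0).obj X)
      (((singleFunctor H 0).obj Y)⟦(2:ℤ)⟧))
    {Z : H} {B : DerivedCategory H} (h : (singleFunctor H 0).obj Z ⟶ B)
    (ha : ∀ R, BddObj H R → R.IsGE 1 → Orth R B)
    (hb : ∀ (M : H) (t : M ⟶ Z), ¬ IsRetr t → (singleFunctor H 0).map t ≫ h = 0)
    {W : DerivedCategory H} (hW : BddObj H W) (t : W ⟶ ((singleFunctor H 0).obj Z)⟦(1:ℤ)⟧)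
    (ht : ¬ IsRetr t) : t ≫ h⟦(1:ℤ)⟧' = 0 := by
  let c := (shiftEquiv (DerivedCategory H) (1:ℤ)).counitIso.app W
  change W⟦(-1:ℤ)⟧⟦(1:ℤ)⟧ ≅ W at c
  obtain ⟨k, hk⟩ := (shiftFunctor _ (1:ℤ)).map_surjective (c.hom ≫ t)
  have hk0 : k ≫ h = 0 := by
    refine lemmaR h2 h ha hb (hW.shift (-1)) k (fun ⟨s, hs⟩ => ht ⟨s⟦(1:ℤ)⟧' ≫ c.hom, ?_⟩)
    rw [Category.assoc, ← hk, ← Functor.map_comp, hs, CategoryTheory.Functor.map_id]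
  rw [← cancel_epi c.hom, ← Category.assoc, ← hk, ← Functor.map_comp, hk0]
  simp

lemma lemmaL' (h2 : ∀ X Y : H, Orth ((singleFunctor H 0).obj X)
      (((singleFunctor H 0).obj Y)⟦(2:ℤ)⟧))
    {X : H} {B : DerivedCategory H} (h : B ⟶ ((singleFunctor H 0).obj X)⟦(1:ℤ)⟧)
    (ha : ∀ N, BddObj H N → N.IsLE (-1) → Orth B (N⟦(1:ℤ)⟧))
    (hb : ∀ (M : H) (t : X ⟶ M), ¬ IsSect t → h ≫ ((singleFunctor H 0).map t)⟦(1:ℤ)⟧' = 0)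
    {W : DerivedCategory H} (hW : BddObj H W) (t : (singleFunctor H 0).obj X ⟶ W)
    (ht : ¬ IsSect t) : h ≫ t⟦(1:ℤ)⟧' = 0 := by
  let c := (shiftEquiv (DerivedCategory H) (1:ℤ)).counitIso.app B
  change B⟦(-1:ℤ)⟧⟦(1:ℤ)⟧ ≅ B at c
  obtain ⟨k, hk⟩ := (shiftFunctor _ (1:ℤ)).map_surjective (c.hom ≫ h)
  have hk0 : k ≫ t = 0 := by
    refine lemmaL h2 k (fun N bN hN => ((ha N bN hN).of_iso c.symm (Iso.refl _)).of_shift 1) ?_ hW t ht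
    intro M t0 ht0
    apply (shiftFunctor _ (1:ℤ)).map_injective
    rw [Functor.map_comp, hk, Category.assoc, hb M t0 ht0]
    simp
  rw [← cancel_epi c.hom, ← Category.assoc, ← hk, ← Functor.map_comp, hk0]
  simp

lemma isAS_of {T : Triangle (DerivedCategory H)} (hT : T ∈ distTriang _)
    (b1 : BddObj H T.obj₁) (b3 : BddObj H T.obj₃) (hl : LeftAS (BddObj H) T.mor₁)
    (hr : RightAS (BddObj H) T.mor₂) : IsASTriangle H T :=
  ⟨hT, b1, BddObj.ext₂ hT b1 b3, b3, ⟨hl, leftMin_of_AS hT b3 hr⟩, hr, rightMin_of_AS hT b1 hl hr⟩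

lemma IsASTriangle.of_iso {T T' : Triangle (DerivedCategory H)} (h : IsASTriangle H T)
    (e : T ≅ T') : IsASTriangle H T' := by
  obtain ⟨hT, b1, b2, b3, hl, hr⟩ := h
  have e1 := Triangle.π₁.mapIso e
  have e3 := Triangle.π₃.mapIso e
  exact isAS_of (isomorphic_distinguished _ hT _ e.symm) (b1.of_iso (Triangle.π₁.mapIso e))
    (b3.of_iso (Triangle.π₃.mapIso e))
    (hl.1.of_iso (Triangle.π₁.mapIso e) (Triangle.π₂.mapIso e) e.hom.comm₁)
    (hr.1.of_iso (Triangle.π₂.mapIso e) (Triangle.π₃.mapIso e) e.hom.comm₂)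

lemma IsASTriangle.shift {T : Triangle (DerivedCategory H)} (h : IsASTriangle H T) (n : ℤ) :
    IsASTriangle H ((Triangle.shiftFunctor (DerivedCategory H) n).obj T) := by
  obtain ⟨hT, b1, b2, b3, hl, hr⟩ := h
  have hl' := hl.1.shift (P := BddObj H) (fun X n h => BddObj.shift h n) n
  have hr' := hr.1.shift (P := BddObj H) (fun X n h => BddObj.shift h n) n
  refine isAS_of (Triangle.shift_distinguished _ hT n) (b1.shift n) (b3.shift n) ?_ ?_
  · change LeftAS _ (n.negOnePow • T.mor₁⟦n⟧')
    rcases Int.units_eq_one_or n.negOnePow with h | h <;> rw [h]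
    · simpa using hl'
    · simpa using hl'.neg
  · change RightAS _ (n.negOnePow • T.mor₂⟦n⟧')
    rcases Int.units_eq_one_or n.negOnePow with h | h <;> rw [h]
    · simpa using hr'
    · simpa using hr'.neg

lemma part1 (h2 : ∀ X Y : H, Orth ((singleFunctor H 0).obj X)
      (((singleFunctor H 0).obj Y)⟦(2:ℤ)⟧)) (S : ShortComplex H) (hS : S.ShortExact)
    (h : IsASSeq S) : IsASTriangle H hS.singleTriangle := by
  have hT := hS.singleTriangle_distinguished
  have hT' : Triangle.mk ((singleFunctor H 0).map S.f) ((singleFunctor H 0).map S.g) hS.singleδ ∈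
    distTriang _ := hT
  obtain ⟨-, ⟨hl, -⟩, ⟨hr, -⟩⟩ := h
  have h0 : hS.singleTriangle.mor₃ ≠ 0 := mor3_ne_zero_of_not_retr hT (by
    rintro ⟨s, hs⟩
    change (singleFunctor H 0).obj S.X₃ ⟶ (singleFunctor H 0).obj S.X₂ at s
    obtain ⟨s, rfl⟩ := (singleFunctor H 0).map_surjective s
    exact hr.1 ⟨s, (singleFunctor H 0).map_injective
      ((Functor.map_comp _ _ _).trans (hs.trans (CategoryTheory.Functor.map_id (singleFunctor H 0) S.X₃).symm))⟩)
  refine isAS_of hT (bdd_single _) (bdd_single _) (leftAS_of_mor3 hT h0 ?_)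
    (rightAS_of_mor3 hT h0 ?_)
  · intro W hW t ht
    refine lemmaL' h2 hS.singleδ ?_ ?_ hW t ht
    · intro N bN hN
      exact orth_of_hered h2 (bdd_single _) (bN.shift 1) (single_ge _)
        (shift_le hN 1 (-2) (by omega)) (by omega)
    · intro M t0 ht0
      obtain ⟨u, rfl⟩ := hl.2 trivial t0 ht0
      rw [Functor.map_comp, Functor.map_comp, ← Category.assoc, mk_zero₃₁ hT', zero_comp]
  · intro W hW t ht
    refine lemmaR h2 hS.singleδ ?_ ?_ hW t ht
    · intro N bN hN
      exact orth_of_hered h2 bN ((bdd_single _).shift 1) hN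
        (shift_le (single_le _) 1 (-1) (by omega)) (by omega)
    · intro M t0 ht0
      obtain ⟨u, rfl⟩ := hr.2 trivial t0 ht0
      rw [Functor.map_comp, Category.assoc, mk_zero₂₃ hT', comp_zero]

end Transfer

section Generic

variable {C : Type uC} [Category.{vC} C] [HasZeroObject C] [HasShift C ℤ] [Preadditive C]
  [∀ n : ℤ, (shiftFunctor C n).Additive] [Pretriangulated C]

lemma rot_mk_iso {X Y Z Z' : C} {f : X ⟶ Y} {v : Y ⟶ Z} {w : Z ⟶ X⟦(1:ℤ)⟧}
    (hT : Triangle.mk f v w ∈ distTriang C) (e : Z ≅ Z') :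
    Triangle.mk (v ≫ e.hom) (e.inv ≫ w) (-f⟦(1:ℤ)⟧') ∈ distTriang C := by
  have hT' : Triangle.mk v w (-f⟦(1:ℤ)⟧') ∈ distTriang C := rot_of_distTriang _ hT
  refine isomorphic_distinguished _ hT' _
    (Triangle.isoMk _ _ (Iso.refl _) e.symm (Iso.refl _) ?_ ?_ ?_)
  · change (v ≫ e.hom) ≫ e.inv = 𝟙 _ ≫ v
    simp
  · change (e.inv ≫ w) ≫ 𝟙 _ = e.inv ≫ w
    simp
  · change (-f⟦(1:ℤ)⟧') ≫ (𝟙 Y)⟦(1:ℤ)⟧' = 𝟙 _ ≫ (-f⟦(1:ℤ)⟧')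
    rw [CategoryTheory.Functor.map_id]
    simp

end Generic

section Part2

variable {H : Type uC} [Category.{vC} H] [Abelian H] [HasDerivedCategory.{w} H]

open DerivedCategory

lemma connecting (h2 : ∀ X Y : H, Orth ((singleFunctor H 0).obj X)
      (((singleFunctor H 0).obj Y)⟦(2:ℤ)⟧)) {P S I : H} (ε : P ⟶ S) (ι : S ⟶ I) [Epi ε] [Mono ι] :
    ∃ (g : (singleFunctor H 0).obj I ⟶
          ((singleFunctor H 0).obj (cokernel ι)) ⊞
            (((singleFunctor H 0).obj (kernel ε))⟦(1 : ℤ)⟧))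
        (h : ((singleFunctor H 0).obj (cokernel ι)) ⊞
            (((singleFunctor H 0).obj (kernel ε))⟦(1 : ℤ)⟧) ⟶
              ((singleFunctor H 0).obj P)⟦(1 : ℤ)⟧),
      Triangle.mk g h (-((singleFunctor H 0).map (ε ≫ ι))⟦(1:ℤ)⟧') ∈ distTriang _ := by
  obtain ⟨δ₁, hT₁⟩ := kernel_triangle ε
  obtain ⟨δ₂, hT₂⟩ := cokernel_triangle ι
  have hT₁' := rot_of_distTriang _ hT₁
  obtain ⟨Z, v, w, hT₃⟩ := distinguished_cocone_triangle ((singleFunctor H 0).map (ε ≫ ι))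
  let o := Triangulated.someOctahedron ((singleFunctor H 0).map_comp ε ι).symm hT₁' hT₂ hT₃
  have hz : δ₂ ≫ δ₁⟦(1:ℤ)⟧' = 0 := by
    refine orth_of_hered h2 (a := 0) (b := -2) (bdd_single _)
      (((bdd_single (kernel ε)).shift 1).shift 1) (single_ge _) ?_ (by omega) _
    exact shift_le (shift_le (single_le _) 1 (-1) (by omega)) 1 (-2) (by omega)
  obtain ⟨e, -, -⟩ := exists_iso_binaryBiproduct_of_distTriang _ o.mem hz
  let e' : Z ≅ ((singleFunctor H 0).obj (cokernel ι)) ⊞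
            (((singleFunctor H 0).obj (kernel ε))⟦(1 : ℤ)⟧) := e ≪≫ biprod.braiding _ _
  exact ⟨v ≫ e'.hom, e'.inv ≫ w, rot_mk_iso hT₃ e'⟩

lemma part2_aux (h2 : ∀ X Y : H, Orth ((singleFunctor H 0).obj X)
      (((singleFunctor H 0).obj Y)⟦(2:ℤ)⟧)) (S₀ P I : H) (ε : P ⟶ S₀) (ι : S₀ ⟶ I)
    (hS : Simple S₀) (hP : Projective P) (hε : SupEpiOn (fun _ => True) ε)
    (hI : Injective I) (hι : EssMonoOn (fun _ => True) ι) {M : DerivedCategory H}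
    (g : (singleFunctor H 0).obj I ⟶ M) (h : M ⟶ ((singleFunctor H 0).obj P)⟦(1 : ℤ)⟧)
    (hT : Triangle.mk g h (-((singleFunctor H 0).map (ε ≫ ι))⟦(1:ℤ)⟧') ∈ distTriang _) :
    IsASTriangle H (Triangle.mk g h (-((singleFunctor H 0).map (ε ≫ ι))⟦(1:ℤ)⟧')) := by
  obtain ⟨hε1, hε2⟩ := hε
  obtain ⟨hι1, hι2⟩ := hι
  have hne : ε ≫ ι ≠ 0 := by
    intro h0
    have h1 : ε = 0 := by rw [← cancel_mono ι, h0, zero_comp]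
    have h3 : 𝟙 S₀ = 0 := by rw [← cancel_epi ε, h1, zero_comp, zero_comp]
    exact Simple.not_isZero S₀ ((IsZero.iff_id_eq_zero _).2 h3)
  have h0 : (Triangle.mk g h (-((singleFunctor H 0).map (ε ≫ ι))⟦(1:ℤ)⟧')).mor₃ ≠ 0 := by
    change (-((singleFunctor H 0).map (ε ≫ ι))⟦(1:ℤ)⟧') ≠ 0
    rw [neg_ne_zero]
    intro h
    apply hne
    apply (singleFunctor H 0).map_injective
    apply (shiftFunctor (DerivedCategory H) (1:ℤ)).map_injective
    rw [h]; simp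
  refine isAS_of hT (bdd_single _) ((bdd_single _).shift 1) (leftAS_of_mor3 hT h0 ?_)
    (rightAS_of_mor3 hT h0 ?_)
  · intro W hW t ht
    change (singleFunctor H 0).obj I ⟶ W at t
    change (-((singleFunctor H 0).map (ε ≫ ι))⟦(1:ℤ)⟧') ≫ t⟦(1:ℤ)⟧' = 0
    rw [Preadditive.neg_comp, ← Functor.map_comp, lemmaL h2 _ ?_ ?_ hW t ht]
    · simp
    · intro N bN hN
      exact orth_proj hP hN
    · intro M t0 ht0
      suffices ι ≫ t0 = 0 by rw [← Functor.map_comp, Category.assoc, this]; simp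
      by_contra hc
      have : Mono (ι ≫ t0) := mono_of_nonzero_from_simple hc
      have := hι2 trivial t0 this
      exact ht0 ⟨Injective.factorThru (𝟙 I) t0, by simp⟩
  · intro W hW t ht
    change W ⟶ ((singleFunctor H 0).obj P)⟦(1 : ℤ)⟧ at t
    change t ≫ (-((singleFunctor H 0).map (ε ≫ ι))⟦(1:ℤ)⟧') = 0
    rw [Preadditive.comp_neg, lemmaR' h2 _ ?_ ?_ hW t ht]
    · simp
    · intro N bN hN
      exact orth_inj h2 hI bN hN
    · intro M t0 ht0
      suffices t0 ≫ ε = 0 by rw [← Functor.map_comp, ← Category.assoc, this]; simp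
      by_contra hc
      have : Epi (t0 ≫ ε) := epi_of_nonzero_to_simple hc
      have := hε2 trivial t0 this
      exact ht0 ⟨Projective.factorThru (𝟙 P) t0, by simp⟩

end Part2

section Part3

variable {H : Type uC} [Category.{vC} H] [Abelian H] [HasDerivedCategory.{w} H]

open DerivedCategory

lemma indec_split (h2 : ∀ X Y : H, Orth ((singleFunctor H 0).obj X)
      (((singleFunctor H 0).obj Y)⟦(2:ℤ)⟧)) {X : DerivedCategory H} (hX : Indec X)
    (bX : BddObj H X) (n : ℤ) : X.IsLE n ∨ X.IsGE (n + 1) := by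
  obtain ⟨A, B, i, p, δ, hT, hA, hB, bA, bB, -, -⟩ := exists_trunc_bdd bX n
  have hδ : δ = 0 := orth_of_hered h2 bB (bA.shift 1) hB
    (shift_le hA 1 (n - 1) (by omega)) (by omega) δ
  obtain ⟨s, hs⟩ := mk_coyoneda₃ hT (𝟙 B) (by rw [hδ, comp_zero])
  rcases hX.2 (p ≫ s) (by rw [Category.assoc, ← Category.assoc s, ← hs, Category.id_comp]) with h | h
  · left
    have hz : IsZero B := (IsZero.iff_id_eq_zero _).2 (by
      rw [← Category.comp_id (𝟙 B), hs, Category.assoc, ← Category.assoc p, h, zero_comp, comp_zero])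
    exact TStructure.t.isLE₂ _ hT n hA (TStructure.t.isLE_of_isZero hz n)
  · right
    have hi : i = 0 := by
      rw [← Category.comp_id i, ← h, ← Category.assoc, mk_zero₁₂ hT, zero_comp]
    obtain ⟨u, hu⟩ := mk_yoneda₁ hT (𝟙 A) (by rw [hδ, zero_comp])
    have hz : IsZero A := (IsZero.iff_id_eq_zero _).2 (by rw [hu, hi, zero_comp])
    exact TStructure.t.isGE₂ _ hT (n+1) (TStructure.t.isGE_of_isZero hz _) hB

lemma indec_stalk (h2 : ∀ X Y : H, Orth ((singleFunctor H 0).obj X)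
      (((singleFunctor H 0).obj Y)⟦(2:ℤ)⟧)) {X : DerivedCategory H} (hX : Indec X)
    (bX : BddObj H X) : ∃ n : ℤ, X.IsGE n ∧ X.IsLE n := by
  obtain ⟨a, b, ha, hb⟩ := (bdd_iff _).1 bX
  obtain ⟨n, hn, hn'⟩ := Int.exists_greatest_of_bdd (P := fun n => X.IsGE n)
    ⟨b, fun z hz => by
      by_contra hlt
      exact hX.1 ((IsZero.iff_id_eq_zero _).2 (zero_le_ge hb hz (by omega) _))⟩ ⟨a, ha⟩
  refine ⟨n, hn, (indec_split h2 hX bX n).resolve_right (fun h => ?_)⟩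
  have := hn' _ h
  omega

lemma retr_map {X Y : H} {f : X ⟶ Y} (h : IsRetr ((singleFunctor H 0).map f)) : IsRetr f := by
  obtain ⟨s, hs⟩ := h
  obtain ⟨s, rfl⟩ := (singleFunctor H 0).map_surjective s
  exact ⟨s, (singleFunctor H 0).map_injective
    ((Functor.map_comp _ _ _).trans (hs.trans (CategoryTheory.Functor.map_id (singleFunctor H 0) _).symm))⟩

lemma sect_map {X Y : H} {f : X ⟶ Y} (h : IsSect ((singleFunctor H 0).map f)) : IsSect f := by
  obtain ⟨s, hs⟩ := h
  obtain ⟨s, rfl⟩ := (singleFunctor H 0).map_surjective s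
  exact ⟨s, (singleFunctor H 0).map_injective
    ((Functor.map_comp _ _ _).trans (hs.trans (CategoryTheory.Functor.map_id (singleFunctor H 0) _).symm))⟩

lemma retr_shift {X Y : DerivedCategory H} {f : X ⟶ Y} (h : IsRetr (f⟦(1:ℤ)⟧')) : IsRetr f := by
  obtain ⟨s, hs⟩ := h
  obtain ⟨s, rfl⟩ := (shiftFunctor _ (1:ℤ)).map_surjective s
  exact ⟨s, (shiftFunctor _ (1:ℤ)).map_injective
    ((Functor.map_comp _ _ _).trans (hs.trans (CategoryTheory.Functor.map_id _ _).symm))⟩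

lemma core1_aux {X Y Z : H} {f : X ⟶ Y} {g : Y ⟶ Z}
    {h : (singleFunctor H 0).obj Z ⟶ ((singleFunctor H 0).obj X)⟦(1:ℤ)⟧}
    (hT : IsASTriangle H (Triangle.mk ((singleFunctor H 0).map f) ((singleFunctor H 0).map g) h)) :
    ∃ (S : ShortComplex H) (hS : S.ShortExact), IsASSeq S ∧
      Nonempty (Triangle.mk ((singleFunctor H 0).map f) ((singleFunctor H 0).map g) h ≅
        hS.singleTriangle) := by
  obtain ⟨hd, -, -, -, ⟨hl, hlm⟩, ⟨hr, hrm⟩⟩ := hT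
  change LeftAS _ ((singleFunctor H 0).map f) at hl
  change RightAS _ ((singleFunctor H 0).map g) at hr
  change LeftMin ((singleFunctor H 0).map f) at hlm
  change RightMin ((singleFunctor H 0).map g) at hrm
  have w : f ≫ g = 0 := (singleFunctor H 0).map_injective (by
    rw [Functor.map_comp, mk_zero₁₂ hd, Functor.map_zero])
  have hf : Mono f := Preadditive.mono_of_cancel_zero _ (fun {K} k hk => by
    obtain ⟨u, hu⟩ := mk_coyoneda₁ hd (((singleFunctor H 0).map k)⟦(1:ℤ)⟧') (by
      rw [← Functor.map_comp, ← Functor.map_comp, hk]; simp)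
    rw [zero_le_ge (shift_le (single_le K) 1 (-1) (by omega)) (single_ge Z) (by omega) u,
      zero_comp] at hu
    apply (singleFunctor H 0).map_injective
    apply (shiftFunctor (DerivedCategory H) (1:ℤ)).map_injective
    rw [hu]; simp)
  have hg : Epi g := Preadditive.epi_of_cancel_zero _ (fun {K} k hk => by
    obtain ⟨u, hu⟩ := mk_yoneda₃ hd ((singleFunctor H 0).map k) (by
      rw [← Functor.map_comp, hk]; simp)
    rw [zero_le_ge (shift_le (single_le X) 1 (-1) (by omega)) (single_ge K) (by omega) u,
      comp_zero] at hu
    apply (singleFunctor H 0).map_injective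
    rw [hu]; simp)
  have hex : ∀ {K : H} (k : K ⟶ Y), k ≫ g = 0 → ∃ l : K ⟶ X, l ≫ f = k := fun {K} k hk => by
    obtain ⟨u, hu⟩ := mk_coyoneda₂ hd ((singleFunctor H 0).map k) (by
      rw [← Functor.map_comp, hk]; simp)
    obtain ⟨l, rfl⟩ := (singleFunctor H 0).map_surjective u
    exact ⟨l, (singleFunctor H 0).map_injective (by rw [Functor.map_comp, hu])⟩
  let S : ShortComplex H := ShortComplex.mk f g w
  have hS : S.ShortExact :=
    { exact := ShortComplex.exact_of_f_is_kernel S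
        (KernelFork.IsLimit.ofι' f w (fun k hk => ⟨(hex k hk).choose, (hex k hk).choose_spec⟩))
      mono_f := hf
      epi_g := hg }
  refine ⟨S, hS, ⟨hS, ⟨⟨?_, ?_⟩, ?_⟩, ⟨?_, ?_⟩, ?_⟩, ⟨isoTriangleOfIso₁₂ _ _ hd
    hS.singleTriangle_distinguished (Iso.refl _) (Iso.refl _) ?_⟩⟩
  · rintro ⟨s, hs⟩
    exact hl.1 ⟨(singleFunctor H 0).map s, by
      rw [← Functor.map_comp]; exact (congrArg _ hs).trans (CategoryTheory.Functor.map_id _ _)⟩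
  · intro M _ t ht
    obtain ⟨u, hu⟩ := hl.2 (bdd_single M) ((singleFunctor H 0).map t) (fun h => ht (sect_map h))
    obtain ⟨l, rfl⟩ := (singleFunctor H 0).map_surjective u
    exact ⟨l, (singleFunctor H 0).map_injective ((Functor.map_comp _ _ _).trans hu)⟩
  · intro u hu
    have := hlm ((singleFunctor H 0).map u) (by rw [← Functor.map_comp]; exact congrArg _ hu)
    exact isIso_of_reflects_iso u (singleFunctor H 0)
  · rintro ⟨s, hs⟩
    exact hr.1 ⟨(singleFunctor H 0).map s, by
      rw [← Functor.map_comp]; exact (congrArg _ hs).trans (CategoryTheory.Functor.map_id _ _)⟩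
  · intro M _ t ht
    obtain ⟨u, hu⟩ := hr.2 (bdd_single M) ((singleFunctor H 0).map t) (fun h => ht (retr_map h))
    obtain ⟨l, rfl⟩ := (singleFunctor H 0).map_surjective u
    exact ⟨l, (singleFunctor H 0).map_injective ((Functor.map_comp _ _ _).trans hu)⟩
  · intro u hu
    have := hrm ((singleFunctor H 0).map u) (by rw [← Functor.map_comp]; exact congrArg _ hu)
    exact isIso_of_reflects_iso u (singleFunctor H 0)
  · change (singleFunctor H 0).map f ≫ 𝟙 _ = 𝟙 _ ≫ (singleFunctor H 0).map f
    rw [Category.comp_id, Category.id_comp]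

lemma mk_iso {X Y Z X' Y' Z' : DerivedCategory H} {f : X ⟶ Y} {g : Y ⟶ Z} {h : Z ⟶ X⟦(1:ℤ)⟧}
    (e₁ : X ≅ X') (e₂ : Y ≅ Y') (e₃ : Z ≅ Z') :
    Nonempty (Triangle.mk f g h ≅ Triangle.mk (e₁.inv ≫ f ≫ e₂.hom) (e₂.inv ≫ g ≫ e₃.hom)
      (e₃.inv ≫ h ≫ e₁.hom⟦(1:ℤ)⟧')) := by
  refine ⟨Triangle.isoMk _ _ e₁ e₂ e₃ ?_ ?_ ?_⟩
  · change f ≫ e₂.hom = e₁.hom ≫ e₁.inv ≫ f ≫ e₂.hom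
    simp
  · change g ≫ e₃.hom = e₂.hom ≫ e₂.inv ≫ g ≫ e₃.hom
    simp
  · change h ≫ e₁.hom⟦(1:ℤ)⟧' = e₃.hom ≫ e₃.inv ≫ h ≫ e₁.hom⟦(1:ℤ)⟧'
    simp

lemma core1 {X Y Z : DerivedCategory H} {f : X ⟶ Y} {g : Y ⟶ Z} {h : Z ⟶ X⟦(1:ℤ)⟧}
    (hT : IsASTriangle H (Triangle.mk f g h)) (hX : X.IsGE 0) (hX' : X.IsLE 0)
    (hZ : Z.IsGE 0) (hZ' : Z.IsLE 0) :
    ∃ (S : ShortComplex H) (hS : S.ShortExact), IsASSeq S ∧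
      Nonempty (Triangle.mk f g h ≅ hS.singleTriangle) := by
  have hY : Y.IsGE 0 := TStructure.t.isGE₂ _ hT.1 0 hX hZ
  have hY' : Y.IsLE 0 := TStructure.t.isLE₂ _ hT.1 0 hX' hZ'
  obtain ⟨X0, ⟨e₁⟩⟩ := stalk0 hX hX'
  obtain ⟨Y0, ⟨e₂⟩⟩ := stalk0 hY hY'
  obtain ⟨Z0, ⟨e₃⟩⟩ := stalk0 hZ hZ'
  obtain ⟨E⟩ := mk_iso (f := f) (g := g) (h := h) e₁ e₂ e₃
  have hT' := hT.of_iso E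
  obtain ⟨f0, hf0⟩ := (singleFunctor H 0).map_surjective (e₁.inv ≫ f ≫ e₂.hom)
  obtain ⟨g0, hg0⟩ := (singleFunctor H 0).map_surjective (e₂.inv ≫ g ≫ e₃.hom)
  rw [← hf0, ← hg0] at hT' E
  obtain ⟨S, hS, h1, ⟨E'⟩⟩ := core1_aux hT'
  exact ⟨S, hS, h1, ⟨E ≪≫ E'⟩⟩

end Part3

section Part3b

variable {H : Type uC} [Category.{vC} H] [Abelian H]

lemma proj_of {X Z : H} {φ : Z ⟶ X} (h0 : φ ≠ 0)
    (hR : ∀ (M : H) (t : M ⟶ Z), ¬ IsRetr t → t ≫ φ = 0) : Projective Z where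
  factors {E B} f e he := by
    by_cases hr : IsRetr (pullback.fst f e)
    · obtain ⟨s, hs⟩ := hr
      exact ⟨s ≫ pullback.snd f e, by
        rw [Category.assoc, ← pullback.condition, ← Category.assoc, hs, Category.id_comp]⟩
    · exact absurd (by rw [← cancel_epi (pullback.fst f e), hR _ _ hr, comp_zero]) h0

lemma inj_of {X Z : H} {φ : Z ⟶ X} (h0 : φ ≠ 0)
    (hL : ∀ (M : H) (t : X ⟶ M), ¬ IsSect t → φ ≫ t = 0) : Injective X where
  factors {B E} f e he := by
    by_cases hr : IsSect (pushout.inl f e)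
    · obtain ⟨s, hs⟩ := hr
      exact ⟨pushout.inr f e ≫ s, by
        rw [← Category.assoc, ← pushout.condition, Category.assoc, hs, Category.comp_id]⟩
    · exact absurd (by rw [← cancel_mono (pushout.inl f e), hL _ _ hr, zero_comp]) h0

lemma image_data {X Z : H} {φ : Z ⟶ X} (h0 : φ ≠ 0)
    (hR : ∀ (M : H) (t : M ⟶ Z), ¬ IsRetr t → t ≫ φ = 0)
    (hL : ∀ (M : H) (t : X ⟶ M), ¬ IsSect t → φ ≫ t = 0) :
    ∃ (S : H) (ε : Z ⟶ S) (ι : S ⟶ X), ε ≫ ι = φ ∧ Simple S ∧ SupEpiOn (fun _ => True) ε ∧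
      EssMonoOn (fun _ => True) ι := by
  have hfac := image.fac φ
  set ε := factorThruImage φ
  set ι := image.ι φ
  have hε : Epi ε := inferInstanceAs (Epi (factorThruImage φ))
  have hι : Mono ι := inferInstanceAs (Mono (image.ι φ))
  have hS : 𝟙 (image φ) ≠ 0 := fun h => h0 (by
    rw [← hfac, ← Category.id_comp ι, h, zero_comp, comp_zero])
  have hR' : ∀ (M : H) (t : M ⟶ Z), ¬ IsRetr t → t ≫ ε = 0 := fun M t ht => by
    rw [← cancel_mono ι, Category.assoc, hfac, hR M t ht, zero_comp]
  have hL' : ∀ (M : H) (t : X ⟶ M), ¬ IsSect t → ι ≫ t = 0 := fun M t ht => by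
    rw [← cancel_epi ε, ← Category.assoc, hfac, hL M t ht, comp_zero]
  refine ⟨image φ, ε, ι, hfac, ⟨fun {Y} j hj => ⟨fun hi h => hS ?_, fun hj0 => ?_⟩⟩, ⟨hε, ?_⟩, ⟨hι, ?_⟩⟩
  · rw [← cancel_epi j, Category.comp_id, comp_zero, h]
  · have : IsRetr (pullback.fst ε j) := by
      by_contra hc
      have h1 := hR' _ _ hc
      rw [pullback.condition] at h1
      exact hj0 (by rw [← cancel_epi (pullback.snd ε j), h1, comp_zero])
    obtain ⟨s, hs⟩ := this
    have h1 : (s ≫ pullback.snd ε j) ≫ j = ε := by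
      rw [Category.assoc, ← pullback.condition, ← Category.assoc, hs, Category.id_comp]
    have : Epi ((s ≫ pullback.snd ε j) ≫ j) := by rw [h1]; exact hε
    have : Epi j := epi_of_epi (s ≫ pullback.snd ε j) j
    exact isIso_of_mono_of_epi j
  · intro W _ g hg
    by_cases hr : IsRetr g
    · obtain ⟨s, hs⟩ := hr
      exact (SplitEpi.mk s hs).epi
    · have h1 := hR' _ g hr
      exact absurd (by rw [← cancel_epi (g ≫ ε), h1, zero_comp, zero_comp]) hS
  · intro W _ g hg
    by_cases hr : IsSect g
    · obtain ⟨s, hs⟩ := hr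
      exact (SplitMono.mk s hs).mono
    · have h1 := hL' _ g hr
      exact absurd (by rw [← cancel_mono (ι ≫ g), h1, comp_zero, comp_zero]) hS

variable [HasDerivedCategory.{w} H]

open DerivedCategory

lemma core2_aux (h2 : ∀ X Y : H, Orth ((singleFunctor H 0).obj X)
      (((singleFunctor H 0).obj Y)⟦(2:ℤ)⟧)) {X Z : H} {Y : DerivedCategory H}
    {f : (singleFunctor H 0).obj X ⟶ Y} {g : Y ⟶ ((singleFunctor H 0).obj Z)⟦(1:ℤ)⟧} {φ : Z ⟶ X}
    (hT : IsASTriangle H (Triangle.mk f g (((singleFunctor H 0).map φ)⟦(1:ℤ)⟧'))) :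
    ∃ T' : Triangle (DerivedCategory H), IsConnectingTriangle H T' ∧ IsASTriangle H T' ∧
      Nonempty (Triangle.mk f g (((singleFunctor H 0).map φ)⟦(1:ℤ)⟧') ≅ T') := by
  have hT0 := hT
  obtain ⟨hd, -, -, -, ⟨hl, -⟩, ⟨hr, -⟩⟩ := hT
  have hz : ∀ {A B : H} (k : A ⟶ B), ((singleFunctor H 0).map k)⟦(1:ℤ)⟧' = 0 → k = 0 := by
    intro A B k hk
    apply (singleFunctor H 0).map_injective
    apply (shiftFunctor (DerivedCategory H) (1:ℤ)).map_injective
    rw [hk]; simp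
  have h0 : φ ≠ 0 := by
    rintro rfl
    exact mor3_ne_zero_of_not_retr hd hr.1 (by
      change ((singleFunctor H 0).map 0)⟦(1:ℤ)⟧' = 0
      simp)
  have hR : ∀ (M : H) (t : M ⟶ Z), ¬ IsRetr t → t ≫ φ = 0 := fun M t ht => hz _ (by
    rw [Functor.map_comp, Functor.map_comp]
    exact hr.comp_mor3 hd ((bdd_single M).shift 1) _ (fun h => ht (retr_map (retr_shift h))))
  have hL : ∀ (M : H) (t : X ⟶ M), ¬ IsSect t → φ ≫ t = 0 := fun M t ht => hz _ (by
    rw [Functor.map_comp, Functor.map_comp]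
    exact hl.mor3_comp hd (bdd_single M) _ (fun h => ht (sect_map h)))
  obtain ⟨S, ε, ι, rfl, hS, hε, hι⟩ := image_data h0 hR hL
  have := hε.1
  have := hι.1
  obtain ⟨g', h', hT'⟩ := connecting h2 ε ι
  have hP := proj_of h0 hR
  have hI := inj_of h0 hL
  have hAS := part2_aux h2 S Z X ε ι hS hP hε hI hι g' h' hT'
  refine ⟨_, ⟨S, Z, X, ε, ι, hS, hP, hε, hI, hι, g', h', _, ⟨Iso.refl _⟩⟩, hAS,
    ⟨isoTriangleOfIso₁₃ _ _ hd hT' (Iso.refl _)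
      ⟨-𝟙 (((singleFunctor H 0).obj Z)⟦(1:ℤ)⟧), -𝟙 (((singleFunctor H 0).obj Z)⟦(1:ℤ)⟧), ?_, ?_⟩ ?_⟩⟩
  · change (-𝟙 (((singleFunctor H 0).obj Z)⟦(1:ℤ)⟧)) ≫ (-𝟙 (((singleFunctor H 0).obj Z)⟦(1:ℤ)⟧)) = 𝟙 _
    simp
  · change (-𝟙 (((singleFunctor H 0).obj Z)⟦(1:ℤ)⟧)) ≫ (-𝟙 (((singleFunctor H 0).obj Z)⟦(1:ℤ)⟧)) = 𝟙 _
    simp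
  · change ((singleFunctor H 0).map (ε ≫ ι))⟦(1:ℤ)⟧' ≫ (𝟙 ((singleFunctor H 0).obj X))⟦(1:ℤ)⟧' =
      (-𝟙 (((singleFunctor H 0).obj Z)⟦(1:ℤ)⟧)) ≫ (-((singleFunctor H 0).map (ε ≫ ι))⟦(1:ℤ)⟧')
    rw [CategoryTheory.Functor.map_id, Category.comp_id, Preadditive.neg_comp_neg, Category.id_comp]

lemma core2 (h2 : ∀ X Y : H, Orth ((singleFunctor H 0).obj X)
      (((singleFunctor H 0).obj Y)⟦(2:ℤ)⟧))
    {X Y Z : DerivedCategory H} {f : X ⟶ Y} {g : Y ⟶ Z} {h : Z ⟶ X⟦(1:ℤ)⟧}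
    (hT : IsASTriangle H (Triangle.mk f g h)) (hX : X.IsGE 0) (hX' : X.IsLE 0)
    (hZ : Z.IsGE (-1)) (hZ' : Z.IsLE (-1)) :
    ∃ T' : Triangle (DerivedCategory H), IsConnectingTriangle H T' ∧ IsASTriangle H T' ∧
      Nonempty (Triangle.mk f g h ≅ T') := by
  obtain ⟨X0, ⟨e₁⟩⟩ := stalk0 hX hX'
  obtain ⟨Z0, ⟨e₃⟩⟩ := stalk hZ hZ'
  rw [neg_neg] at e₃
  obtain ⟨E⟩ := mk_iso (f := f) (g := g) (h := h) e₁ (Iso.refl Y) e₃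
  have hT' := hT.of_iso E
  obtain ⟨h1, hh1⟩ := (shiftFunctor _ (1:ℤ)).map_surjective (e₃.inv ≫ h ≫ e₁.hom⟦(1:ℤ)⟧')
  obtain ⟨φ, rfl⟩ := (singleFunctor H 0).map_surjective h1
  rw [← hh1] at hT' E
  obtain ⟨T', h1, h3, ⟨E'⟩⟩ := core2_aux h2 hT'
  exact ⟨T', h1, h3, ⟨E ≪≫ E'⟩⟩

lemma part3 (h2 : ∀ X Y : H, Orth ((singleFunctor H 0).obj X)
      (((singleFunctor H 0).obj Y)⟦(2:ℤ)⟧)) (T : Triangle (DerivedCategory H))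
    (hT : IsASTriangle H T) :
      ∃ n : ℤ,
        (∃ (S : ShortComplex H) (hS : S.ShortExact), IsASSeq S ∧
          Nonempty (T ≅ (Triangle.shiftFunctor (DerivedCategory H) n).obj
            hS.singleTriangle)) ∨
        (∃ T' : Triangle (DerivedCategory H), IsConnectingTriangle H T' ∧ IsASTriangle H T' ∧
          Nonempty (T ≅ (Triangle.shiftFunctor (DerivedCategory H) n).obj T')) := by
  obtain ⟨hd, b1, b2, b3, ⟨hl, -⟩, ⟨hr, -⟩⟩ := id hT
  obtain ⟨i, hi, hi'⟩ := indec_stalk h2 (hl.indec b1) b1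
  obtain ⟨j, hj, hj'⟩ := indec_stalk h2 (hr.indec b3) b3
  have h3 := mor3_ne_zero_of_not_retr hd hr.1
  have c1 : ¬ (j < i - 1) := fun hlt => h3
    (zero_le_ge hj' (shift_ge hi 1 (i - 1) (by omega)) hlt _)
  have c2 : ¬ ((i - 1) + 2 ≤ j) := fun hlt => h3
    (orth_of_hered h2 b3 (b1.shift 1) hj (shift_le hi' 1 (i - 1) (by omega)) hlt _)
  have hT' := hT.shift i
  have E : T ≅ (Triangle.shiftFunctor _ (-i)).obj ((Triangle.shiftFunctor _ i).obj T) :=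
    (shiftEquiv (Triangle (DerivedCategory H)) i).unitIso.app T
  have hi1 : (T.obj₁⟦i⟧).IsGE 0 := shift_ge hi i 0 (by omega)
  have hi2 : (T.obj₁⟦i⟧).IsLE 0 := shift_le hi' i 0 (by omega)
  refine ⟨-i, ?_⟩
  have hc : j = i ∨ j = i - 1 := by omega
  rcases hc with hc | hc
  · left
    obtain ⟨S, hS, h1, ⟨E'⟩⟩ := core1 hT' hi1 hi2 (shift_ge hj i 0 (by omega))
      (shift_le hj' i 0 (by omega))
    exact ⟨S, hS, h1, ⟨E ≪≫ (Triangle.shiftFunctor _ (-i)).mapIso E'⟩⟩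
  · right
    obtain ⟨T', h1, h3, ⟨E'⟩⟩ := core2 h2 hT' hi1 hi2 (shift_ge hj i (-1) (by omega))
      (shift_le hj' i (-1) (by omega))
    exact ⟨T', h1, h3, ⟨E ≪≫ (Triangle.shiftFunctor _ (-i)).mapIso E'⟩⟩

end Part3b

/-- Let `H` be a hereditary abelian category (formalised by the
vanishing of `Ext²`) and `D^b(H)` its bounded derived category (formalised as the
homologically bounded objects of the derived category). Then:
(1) any almost split sequence `0 → X → Y → Z → 0` in `H` induces an almost split triangle
`X → Y → Z → X[1]` in `D^b(H)` whose connecting morphism is the class of the sequence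
under `Ext¹(Z, X) ≅ Hom(Z, X[1])` (i.e. the canonical triangle of the short exact
sequence);
(2) if `S₀` is a simple object of `H` with a projective cover `ε : P → S₀` and an
injective hull `ι : S₀ → I`, then `D^b(H)` has an almost split triangle
`I → (I/S₀) ⊕ (rad P)[1] → P[1] → I[1]`;
(3) every almost split triangle in `D^b(H)` is isomorphic to a shift of an almost split
triangle of one of these two forms. -/
theorem statement_18 (H : Type uC) [Category.{vC} H] [Abelian H]
    [HasDerivedCategory.{w} H] [HasExt.{w} H]
    (hHered : ∀ (X Y : H) (e : CategoryTheory.Abelian.Ext X Y 2), e = 0) :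
    (∀ (S : ShortComplex H) (hS : S.ShortExact), IsASSeq S →
      IsASTriangle H hS.singleTriangle) ∧
    (∀ (S₀ P I : H) (ε : P ⟶ S₀) (ι : S₀ ⟶ I), Simple S₀ →
      Projective P → SupEpiOn (fun _ => True) ε →
      Injective I → EssMonoOn (fun _ => True) ι →
      ∃ (g : (DerivedCategory.singleFunctor H 0).obj I ⟶
          ((DerivedCategory.singleFunctor H 0).obj (cokernel ι)) ⊞
            (((DerivedCategory.singleFunctor H 0).obj (kernel ε))⟦(1 : ℤ)⟧))
        (h : ((DerivedCategory.singleFunctor H 0).obj (cokernel ι)) ⊞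
            (((DerivedCategory.singleFunctor H 0).obj (kernel ε))⟦(1 : ℤ)⟧) ⟶
              ((DerivedCategory.singleFunctor H 0).obj P)⟦(1 : ℤ)⟧)
        (δ : ((DerivedCategory.singleFunctor H 0).obj P)⟦(1 : ℤ)⟧ ⟶
            ((DerivedCategory.singleFunctor H 0).obj I)⟦(1 : ℤ)⟧),
        IsASTriangle H (Triangle.mk g h δ)) ∧
    (∀ T : Triangle (DerivedCategory H), IsASTriangle H T →
      ∃ n : ℤ,
        (∃ (S : ShortComplex H) (hS : S.ShortExact), IsASSeq S ∧
          Nonempty (T ≅ (Triangle.shiftFunctor (DerivedCategory H) n).obj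
            hS.singleTriangle)) ∨
        (∃ T' : Triangle (DerivedCategory H), IsConnectingTriangle H T' ∧ IsASTriangle H T' ∧
          Nonempty (T ≅ (Triangle.shiftFunctor (DerivedCategory H) n).obj T'))) := by
  have h2 := hered_orth hHered
  refine ⟨part1 h2, ?_, part3 h2⟩
  intro S₀ P I ε ι hS hP hε hI hι
  have := hε.1
  have := hι.1
  obtain ⟨g, h, hT⟩ := connecting h2 ε ι
  exact ⟨g, h, _, part2_aux h2 S₀ P I ε ι hS hP hε hI hι g h hT⟩
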